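/- Let b be a positive integer and let b₁, b₂, c₁, c₂ be nonzero rationals with c₁ ≠ c₂. Define u_n = b₁c₁^n + b₂c₂^n, assumed to lie in ℤ[1/b] for all n ∈ ℤ, and set B = -b₂/b₁, C = c₁/c₂. Suppose that either (1) C^m = B for some m ∈ ℤ, or (2) (C, B) = (1, -1), or (3) B^k·C^ℓ ∉ {±1} for all k ∈ ℤ\{0}, ℓ ∈ ℤ. Then no term u_n is zero if and only if there exist infinitely many primes p with gcd(b, p) = 1 such that u_n ∉ p·ℤ[1/b] for all n ∈ ℤ. -/

import Mathlib

/-- `x ∈ ℤ[1/b]`. -/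
def inZb (b : ℕ) (x : ℚ) : Prop := ∃ (z : ℤ) (j : ℕ), x = z / b ^ j

/-- `x ∈ m·ℤ[1/b]`. -/
def inMulZb (m b : ℕ) (x : ℚ) : Prop := ∃ (z : ℤ) (j : ℕ), x = m * z / b ^ j

section DedekindZeta

open Filter Topology NumberField IsDedekindDomain

/-- A function with finite fibres can be used to regroup a sum over its domain. -/
theorem hasSum_card_fiber {ι : Type*} (N : ι → ℕ) (hN : ∀ n, Finite {i // N i = n})
    {g : ℕ → ℝ} (hg : ∀ n, 0 ≤ g n)
    (hs : Summable fun n ↦ (Nat.card {i // N i = n} : ℝ) * g n) :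
    HasSum (fun i ↦ g (N i)) (∑' n, (Nat.card {i // N i = n} : ℝ) * g n) := by
  have key : ∀ n, HasSum (fun i : {i // N i = n} ↦ g (N i.1))
      ((Nat.card {i // N i = n} : ℝ) * g n) := by
    intro n
    have := Fintype.ofFinite {i // N i = n}
    convert hasSum_fintype (fun i : {i // N i = n} ↦ g (N i.1)) using 1
    rw [Fintype.sum_congr _ (fun _ ↦ g n) fun i ↦ by rw [i.2]]
    simp [Nat.card_eq_fintype_card]
  rw [← (Equiv.sigmaFiberEquiv N).hasSum_iff]
  have hsum : Summable ((fun i ↦ g (N i)) ∘ Equiv.sigmaFiberEquiv N) := by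
    refine (summable_sigma_of_nonneg fun x ↦ hg _).2 ⟨fun n ↦ (key n).summable, ?_⟩
    exact hs.congr fun n ↦ (key n).tsum_eq.symm
  have := hsum.hasSum.sigma key
  rw [this.tsum_eq]
  exact hsum.hasSum

variable (K : Type*) [Field K] [NumberField K]

/-- The number of ideals of norm `n` in the ring of integers of `K`. -/
noncomputable def idealCount (n : ℕ) : ℕ := Nat.card {I : Ideal (𝓞 K) // Ideal.absNorm I = n}

theorem finite_ideals_of_norm (n : ℕ) : Finite {I : Ideal (𝓞 K) // Ideal.absNorm I = n} :=
  (Ideal.finite_setOfPred_absNorm_eq n).to_subtype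

theorem term_idealCount {s : ℝ} (hs : 1 < s) (n : ℕ) :
    LSeries.term (fun n ↦ (idealCount K n : ℂ)) s n =
      (((idealCount K n : ℝ) * (n : ℝ) ^ (-s) : ℝ) : ℂ) := by
  rcases eq_or_ne n 0 with rfl | hn
  · simp [Real.zero_rpow (by linarith : -s ≠ 0)]
  · rw [LSeries.term_of_ne_zero hn, Real.rpow_neg (by positivity), div_eq_mul_inv]
    push_cast
    rw [Complex.ofReal_cpow (by positivity)]
    simp

theorem dedekindZeta_eq_ofReal {s : ℝ} (hs : 1 < s) :
    dedekindZeta K s = ((∑' n, (idealCount K n : ℝ) * (n : ℝ) ^ (-s) : ℝ) : ℂ) := by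
  rw [Complex.ofReal_tsum]
  exact tsum_congr fun n ↦ term_idealCount K hs n

theorem tendsto_sub_one_mul_tsum_idealCount :
    Tendsto (fun s : ℝ ↦ (s - 1) * ∑' n, (idealCount K n : ℝ) * (n : ℝ) ^ (-s)) (𝓝[>] 1)
      (𝓝 (dedekindZeta_residue K)) := by
  have h := (Complex.continuous_re.tendsto _).comp (tendsto_sub_one_mul_dedekindZeta_nhdsGT K)
  refine (h.congr' ?_)
  filter_upwards [self_mem_nhdsWithin] with s hs
  rw [Function.comp_apply, dedekindZeta_eq_ofReal K hs, ← Complex.ofReal_one,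
    ← Complex.ofReal_sub, ← Complex.ofReal_mul, Complex.ofReal_re]

theorem summable_idealCount {s : ℝ} (hs : 1 < s) :
    Summable fun n ↦ (idealCount K n : ℝ) * (n : ℝ) ^ (-s) := by
  have h := (tendsto_sub_one_mul_tsum_idealCount K).eventually_ne
    (dedekindZeta_residue_ne_zero K)
  obtain ⟨t, ht, ht1, hts⟩ := (h.and (Ioo_mem_nhdsGT hs)).exists
  have hsum : Summable fun n ↦ (idealCount K n : ℝ) * (n : ℝ) ^ (-t) := by
    by_contra hcon
    exact ht (by rw [tsum_eq_zero_of_not_summable hcon, mul_zero])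
  refine hsum.of_nonneg_of_le (fun n ↦ by positivity) fun n ↦ ?_
  rcases Nat.eq_zero_or_pos n with rfl | hn
  · simp [Real.zero_rpow (by linarith : -s ≠ 0), Real.zero_rpow (by linarith : -t ≠ 0)]
  · gcongr
    exact_mod_cast hn

/-- The Dedekind zeta function on the real half-line, as a sum over ideals. The zero ideal
contributes nothing. -/
noncomputable def idealZeta (s : ℝ) : ℝ := ∑' I : Ideal (𝓞 K), (Ideal.absNorm I : ℝ) ^ (-s)

theorem hasSum_idealZeta {s : ℝ} (hs : 1 < s) :
    HasSum (fun I : Ideal (𝓞 K) ↦ (Ideal.absNorm I : ℝ) ^ (-s))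
      (∑' n, (idealCount K n : ℝ) * (n : ℝ) ^ (-s)) :=
  hasSum_card_fiber (fun I : Ideal (𝓞 K) ↦ Ideal.absNorm I) (finite_ideals_of_norm K)
    (g := fun n ↦ (n : ℝ) ^ (-s)) (fun n ↦ by positivity) (summable_idealCount K hs)

theorem abs_log_idealZeta_sub_le :
    ∃ M, ∀ᶠ s in 𝓝[>] (1 : ℝ), |Real.log (idealZeta K s) - Real.log (1 / (s - 1))| ≤ M := by
  have hpos := dedekindZeta_residue_pos K
  have h := ((Real.continuousAt_log hpos.ne').tendsto.comp
    (tendsto_sub_one_mul_tsum_idealCount K)).abs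
  have h' := (tendsto_sub_one_mul_tsum_idealCount K).eventually_ne hpos.ne'
  refine ⟨|Real.log (dedekindZeta_residue K)| + 1, ?_⟩
  filter_upwards [h.eventually_le_const (lt_add_one _), h', self_mem_nhdsWithin] with s h1 h2 hs
  rw [Function.comp_apply, ← (hasSum_idealZeta K hs).tsum_eq] at h1
  rw [← (hasSum_idealZeta K hs).tsum_eq] at h2
  rw [Real.log_mul (left_ne_zero_of_mul h2) (right_ne_zero_of_mul h2)] at h1
  rwa [one_div, Real.log_inv, sub_neg_eq_add, add_comm, idealZeta]

/-- The part of the zeta function supported on ideals not divisible by any prime in `S`. -/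
noncomputable def siftedZeta (s : ℝ) (S : Finset (HeightOneSpectrum (𝓞 K))) : ℝ :=
  ∑' I : Ideal (𝓞 K), Set.indicator {I | ∀ v ∈ S, ¬ v.asIdeal ∣ I}
    (fun I ↦ (Ideal.absNorm I : ℝ) ^ (-s)) I

theorem siftedZeta_insert {s : ℝ} (hs : 1 < s) [DecidableEq (HeightOneSpectrum (𝓞 K))]
    (S : Finset (HeightOneSpectrum (𝓞 K))) (w : HeightOneSpectrum (𝓞 K)) (hw : w ∉ S) :
    siftedZeta K s (insert w S) =
      siftedZeta K s S * (1 - (Ideal.absNorm w.asIdeal : ℝ) ^ (-s)) := by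
  classical
  have hsum := (hasSum_idealZeta K hs).summable
  have hinj : Function.Injective fun J : Ideal (𝓞 K) ↦ w.asIdeal * J :=
    mul_right_injective₀ w.ne_bot
  have h2 : ∑' I : Ideal (𝓞 K), Set.indicator {I | w.asIdeal ∣ I ∧ ∀ v ∈ S, ¬ v.asIdeal ∣ I}
      (fun I ↦ (Ideal.absNorm I : ℝ) ^ (-s)) I =
      siftedZeta K s S * (Ideal.absNorm w.asIdeal : ℝ) ^ (-s) := by
    rw [← hinj.tsum_eq, siftedZeta, ← tsum_mul_right]
    · refine tsum_congr fun J ↦ ?_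
      have hiff : (∀ v ∈ S, ¬ v.asIdeal ∣ w.asIdeal * J) ↔ ∀ v ∈ S, ¬ v.asIdeal ∣ J := by
        refine forall₂_congr fun v hv ↦ not_congr ⟨fun h ↦ ?_, fun h ↦ h.mul_left _⟩
        refine (v.prime.dvd_or_dvd h).resolve_left fun h ↦ hw ?_
        have := v.prime.associated_of_dvd w.prime h
        rw [associated_iff_eq] at this
        rwa [← HeightOneSpectrum.ext this]
      by_cases hJ : ∀ v ∈ S, ¬ v.asIdeal ∣ J
      · rw [Set.indicator_of_mem (show w.asIdeal * J ∈ {I | w.asIdeal ∣ I ∧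
          ∀ v ∈ S, ¬ v.asIdeal ∣ I} from ⟨dvd_mul_right _ _, hiff.2 hJ⟩),
          Set.indicator_of_mem (by exact hJ), map_mul, Nat.cast_mul,
          Real.mul_rpow (by positivity) (by positivity), mul_comm]
      · rw [Set.indicator_of_notMem (fun h ↦ hJ (hiff.1 h.2)),
          Set.indicator_of_notMem (by exact hJ), zero_mul]
    · intro I hI
      obtain ⟨J, rfl⟩ := (Set.mem_of_indicator_ne_zero hI).1
      exact ⟨J, rfl⟩
  rw [mul_one_sub, ← h2, siftedZeta, siftedZeta,
    ← (hsum.indicator _).tsum_sub (hsum.indicator _)]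
  refine tsum_congr fun I ↦ ?_
  by_cases h1 : w.asIdeal ∣ I <;> by_cases hS : ∀ v ∈ S, ¬ v.asIdeal ∣ I <;>
    simp [Set.indicator_apply, h1, hS, -not_forall]

theorem siftedZeta_eq {s : ℝ} (hs : 1 < s) (S : Finset (HeightOneSpectrum (𝓞 K))) :
    siftedZeta K s S =
      idealZeta K s * ∏ v ∈ S, (1 - (Ideal.absNorm v.asIdeal : ℝ) ^ (-s)) := by
  classical
  induction S using Finset.induction_on with
  | empty => simp [siftedZeta, idealZeta]
  | insert w S hw ih => rw [siftedZeta_insert K hs S w hw, ih, Finset.prod_insert hw]; ring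

theorem one_le_siftedZeta {s : ℝ} (hs : 1 < s) (S : Finset (HeightOneSpectrum (𝓞 K))) :
    1 ≤ siftedZeta K s S := by
  refine le_of_eq_of_le ?_ (((hasSum_idealZeta K hs).summable.indicator _).le_tsum ⊤
    fun I _ ↦ Set.indicator_nonneg (fun _ _ ↦ by positivity) _)
  rw [Set.indicator_of_mem]
  · simp
  · intro v _ h
    exact v.prime.not_isUnit (isUnit_of_dvd_one (by simpa using h))

theorem tendsto_siftedZeta {s : ℝ} (hs : 1 < s) :
    Tendsto (siftedZeta K s) atTop (𝓝 1) := by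
  classical
  have h : ∑' I : Ideal (𝓞 K), (if I = ⊤ then (1 : ℝ) else 0) = 1 := tsum_ite_eq _ _
  rw [← h]
  refine tendsto_tsum_of_dominated_convergence (hasSum_idealZeta K hs).summable ?_
    (Eventually.of_forall fun S I ↦ ?_)
  · intro I
    by_cases hI : I = ⊤
    · refine tendsto_const_nhds.congr fun S ↦ ?_
      rw [Set.indicator_of_mem]
      · simp [hI]
      · intro v _ h
        exact v.prime.not_isUnit (isUnit_of_dvd_one (by simpa [hI] using h))
    · rw [if_neg hI]
      by_cases h0 : I = ⊥
      · refine tendsto_const_nhds.congr fun S ↦ ?_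
        simp [h0, Set.indicator_apply, Real.zero_rpow (by linarith : -s ≠ 0)]
      · obtain ⟨P, hP, hIP⟩ := Ideal.exists_le_maximal I hI
        let v : HeightOneSpectrum (𝓞 K) := ⟨P, hP.isPrime, fun h ↦ h0 (by simpa [h] using hIP)⟩
        refine tendsto_const_nhds.congr' ?_
        filter_upwards [eventually_ge_atTop {v}] with S hS
        rw [Set.indicator_of_notMem]
        exact fun h ↦ h v (hS (by simp)) (Ideal.dvd_iff_le.2 hIP)
  · exact (norm_indicator_le_norm_self _ _).trans_eq (Real.norm_of_nonneg (by positivity))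

theorem absNorm_rpow_mem {s : ℝ} (hs : 1 < s) (v : HeightOneSpectrum (𝓞 K)) :
    0 < (Ideal.absNorm v.asIdeal : ℝ) ^ (-s) ∧ (Ideal.absNorm v.asIdeal : ℝ) ^ (-s) ≤ 1 / 2 := by
  have h2 : (2 : ℝ) ≤ Ideal.absNorm v.asIdeal := by
    have h0 : Ideal.absNorm v.asIdeal ≠ 0 := by
      rw [Ne, Ideal.absNorm_eq_zero_iff]; exact v.ne_bot
    have h1 : Ideal.absNorm v.asIdeal ≠ 1 := by
      rw [Ne, Ideal.absNorm_eq_one_iff]; exact v.isPrime.ne_top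
    exact_mod_cast (by omega : 2 ≤ Ideal.absNorm v.asIdeal)
  refine ⟨by positivity, ?_⟩
  calc (Ideal.absNorm v.asIdeal : ℝ) ^ (-s) ≤ (Ideal.absNorm v.asIdeal : ℝ) ^ (-1 : ℝ) :=
        Real.rpow_le_rpow_of_exponent_le (by linarith) (by linarith)
    _ = 1 / Ideal.absNorm v.asIdeal := by rw [Real.rpow_neg_one, one_div]
    _ ≤ 1 / 2 := by gcongr

/-- The logarithm of the Euler product. -/
theorem hasSum_neg_log_one_sub {s : ℝ} (hs : 1 < s) :
    HasSum (fun v : HeightOneSpectrum (𝓞 K) ↦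
      -Real.log (1 - (Ideal.absNorm v.asIdeal : ℝ) ^ (-s))) (Real.log (idealZeta K s)) := by
  have h := ((Real.continuousAt_log one_ne_zero).tendsto.comp (tendsto_siftedZeta K hs)).const_sub
    (Real.log (idealZeta K s))
  rw [Real.log_one, sub_zero] at h
  refine h.congr fun S ↦ ?_
  have h0 : siftedZeta K s S ≠ 0 := (zero_lt_one.trans_le (one_le_siftedZeta K hs S)).ne'
  have h1 := siftedZeta_eq K hs S
  rw [h1] at h0
  rw [Function.comp_apply, h1, Real.log_mul (left_ne_zero_of_mul h0) (right_ne_zero_of_mul h0),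
    Real.log_prod fun v _ ↦ by linarith [(absNorm_rpow_mem K hs v).2], Finset.sum_neg_distrib]
  ring

end DedekindZeta

section LogDensity

open Filter Topology

/-- `LogDensity a c` says that `∑ a n * n ^ (-s)` converges for `s > 1` and equals
`c * log (1 / (s - 1)) + O(1)` as `s` tends to `1` from the right. -/
def LogDensity (a : ℕ → ℝ) (c : ℝ) : Prop :=
  (∀ s : ℝ, 1 < s → Summable fun n ↦ a n * (n : ℝ) ^ (-s)) ∧
    ∃ M, ∀ᶠ s in 𝓝[>] (1 : ℝ), |∑' n, a n * (n : ℝ) ^ (-s) - c * Real.log (1 / (s - 1))| ≤ M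

theorem LogDensity.add {a b : ℕ → ℝ} {c d : ℝ} (ha : LogDensity a c) (hb : LogDensity b d) :
    LogDensity (fun n ↦ a n + b n) (c + d) := by
  obtain ⟨ha, M, hM⟩ := ha
  obtain ⟨hb, M', hM'⟩ := hb
  refine ⟨fun s hs ↦ ((ha s hs).add (hb s hs)).congr fun n ↦ by ring, M + M', ?_⟩
  filter_upwards [hM, hM', self_mem_nhdsWithin] with s h h' hs
  simp only [add_mul]
  rw [(ha s hs).tsum_add (hb s hs), add_sub_add_comm]
  exact (abs_add_le _ _).trans (add_le_add h h')

theorem LogDensity.const_mul {a : ℕ → ℝ} {c : ℝ} (ha : LogDensity a c) (k : ℝ) :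
    LogDensity (fun n ↦ k * a n) (k * c) := by
  obtain ⟨ha, M, hM⟩ := ha
  refine ⟨fun s hs ↦ ((ha s hs).mul_left k).congr fun n ↦ by ring, |k| * M, ?_⟩
  filter_upwards [hM] with s h
  simp only [mul_assoc]
  rw [tsum_mul_left, ← mul_sub, abs_mul]
  gcongr

theorem LogDensity.of_finite_support {a : ℕ → ℝ} (ha : {n | a n ≠ 0}.Finite) :
    LogDensity a 0 := by
  have hz : ∀ s : ℝ, ∀ n ∉ ha.toFinset, a n * (n : ℝ) ^ (-s) = 0 := by
    intro s n hn
    have : a n = 0 := by simpa using hn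
    simp [this]
  refine ⟨fun s _ ↦ summable_of_ne_finset_zero (hz s), ∑ n ∈ ha.toFinset, |a n|, ?_⟩
  filter_upwards [self_mem_nhdsWithin] with s hs
  rw [Set.mem_Ioi] at hs
  rw [tsum_eq_sum (hz s), zero_mul, sub_zero]
  refine (Finset.abs_sum_le_sum_abs _ _).trans (Finset.sum_le_sum fun n _ ↦ ?_)
  rw [abs_mul]
  refine mul_le_of_le_one_right (abs_nonneg _) ?_
  rw [abs_of_nonneg (by positivity)]
  rcases Nat.eq_zero_or_pos n with rfl | hn
  · simp [Real.zero_rpow (by linarith : -s ≠ 0)]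
  · exact Real.rpow_le_one_of_one_le_of_nonpos (by exact_mod_cast hn) (by linarith)

theorem LogDensity.congr {a b : ℕ → ℝ} {c : ℝ} (ha : LogDensity a c)
    (h : {n | b n ≠ a n}.Finite) : LogDensity b c := by
  have := ha.add (LogDensity.of_finite_support (a := fun n ↦ b n - a n)
    (by simpa [sub_ne_zero] using h))
  simpa using this

theorem LogDensity.sum {ι : Type*} (s : Finset ι) {a : ι → ℕ → ℝ} {c : ι → ℝ}
    (h : ∀ i ∈ s, LogDensity (a i) (c i)) :
    LogDensity (fun n ↦ ∑ i ∈ s, a i n) (∑ i ∈ s, c i) := by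
  classical
  induction s using Finset.induction_on with
  | empty => simpa using LogDensity.of_finite_support (a := fun _ ↦ 0) (by simp)
  | insert i s hi ih =>
    simp only [Finset.sum_insert hi]
    exact (h i (by simp)).add (ih fun j hj ↦ h j (by simp [hj]))

theorem LogDensity.nonneg {a : ℕ → ℝ} {c : ℝ} (ha : LogDensity a c)
    (h : {n | a n < 0}.Finite) : 0 ≤ c := by
  have h' : LogDensity (fun n ↦ max (a n) 0) c := ha.congr <| h.subset fun n hn ↦ by
    by_contra hcon
    exact hn (max_eq_left (not_lt.1 hcon))
  obtain ⟨-, M, hM⟩ := h'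
  by_contra! hc
  have hlog : Tendsto (fun s : ℝ ↦ Real.log (1 / (s - 1))) (𝓝[>] 1) atTop := by
    refine Real.tendsto_log_atTop.comp ?_
    simp only [one_div]
    refine tendsto_inv_nhdsGT_zero.comp (tendsto_nhdsWithin_iff.2 ⟨?_, ?_⟩)
    · exact (Continuous.tendsto' (by fun_prop) _ _ (by simp)).mono_left nhdsWithin_le_nhds
    · filter_upwards [self_mem_nhdsWithin] with s hs using sub_pos.2 (Set.mem_Ioi.1 hs)
  obtain ⟨s, h1, h2⟩ := (hM.and (hlog.eventually_gt_atTop (M / -c))).exists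
  rw [div_lt_iff₀ (by linarith)] at h2
  have h3 : 0 ≤ ∑' n, max (a n) 0 * (n : ℝ) ^ (-s) := tsum_nonneg fun n ↦ by positivity
  have := (abs_le.1 h1).2
  linarith

end LogDensity

section PrimeIdeals

open Filter Topology NumberField IsDedekindDomain

variable (K : Type*) [Field K] [NumberField K]

theorem isPrimePow_absNorm (v : HeightOneSpectrum (𝓞 K)) :
    IsPrimePow (Ideal.absNorm v.asIdeal) := by
  have := v.isMaximal
  let := Ideal.Quotient.field v.asIdeal
  have : Finite (𝓞 K ⧸ v.asIdeal) := Ideal.finiteQuotientOfFreeOfNeBot _ v.ne_bot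
  have := Fintype.ofFinite (𝓞 K ⧸ v.asIdeal)
  rw [Ideal.absNorm_apply, Submodule.cardQuot_apply, Nat.card_eq_fintype_card]
  exact FiniteField.isPrimePow_card _

theorem card_le_finrank_of_minFac_absNorm (p : ℕ) (S : Finset (HeightOneSpectrum (𝓞 K)))
    (hS : ∀ v ∈ S, (Ideal.absNorm v.asIdeal).minFac = p) :
    S.card ≤ Module.finrank ℤ (𝓞 K) := by
  rcases S.eq_empty_or_nonempty with rfl | ⟨w, hw⟩
  · simp
  have hp : p.Prime := hS w hw ▸ Nat.minFac_prime (isPrimePow_absNorm K w).ne_one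
  have hdvd : ∀ v ∈ S, v.asIdeal ∣ Ideal.span {(p : 𝓞 K)} := by
    intro v hv
    rw [Ideal.dvd_span_singleton]
    have hpow := (isPrimePow_absNorm K v).minFac_pow_factorization_eq
    rw [hS v hv] at hpow
    have := v.asIdeal.absNorm_mem
    rw [← hpow, Nat.cast_pow] at this
    exact v.isPrime.mem_of_pow_mem _ this
  have hprod : ∏ v ∈ S, v.asIdeal ∣ Ideal.span {(p : 𝓞 K)} := by
    have := Finset.prod_primes_dvd (s := S.map ⟨HeightOneSpectrum.asIdeal,
      fun _ _ ↦ HeightOneSpectrum.ext⟩) (Ideal.span {(p : 𝓞 K)})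
      (fun I hI ↦ by obtain ⟨v, -, rfl⟩ := Finset.mem_map.1 hI; exact v.prime)
      (fun I hI ↦ by obtain ⟨v, hv, rfl⟩ := Finset.mem_map.1 hI; exact hdvd v hv)
    rwa [Finset.prod_map] at this
  have h1 := Nat.le_of_dvd (by rw [Ideal.absNorm_span_natCast]; exact pow_pos hp.pos _)
    (map_dvd Ideal.absNorm hprod)
  rw [Ideal.absNorm_span_natCast, map_prod] at h1
  have h2 : p ^ S.card ≤ ∏ v ∈ S, Ideal.absNorm v.asIdeal := by
    refine Finset.pow_card_le_prod _ _ _ fun v hv ↦ ?_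
    rw [← hS v hv]
    exact Nat.minFac_le (isPrimePow_absNorm K v).pos
  exact (Nat.pow_le_pow_iff_right hp.one_lt).1 (h2.trans h1)

theorem finite_minFac_absNorm_fiber (p : ℕ) :
    Finite {v : HeightOneSpectrum (𝓞 K) // (Ideal.absNorm v.asIdeal).minFac = p} := by
  refine Set.not_infinite.1 fun h ↦ ?_
  obtain ⟨S, hS, hcard⟩ := h.exists_subset_card_eq (Module.finrank ℤ (𝓞 K) + 1)
  have := card_le_finrank_of_minFac_absNorm K p S fun v hv ↦ hS hv
  omega

theorem card_minFac_absNorm_fiber_le (p : ℕ) :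
    Nat.card {v : HeightOneSpectrum (𝓞 K) // (Ideal.absNorm v.asIdeal).minFac = p} ≤
      Module.finrank ℤ (𝓞 K) := by
  have := finite_minFac_absNorm_fiber K p
  have := Fintype.ofFinite {v : HeightOneSpectrum (𝓞 K) // (Ideal.absNorm v.asIdeal).minFac = p}
  rw [Nat.card_eq_fintype_card, ← Finset.card_univ, ← Finset.card_map (Function.Embedding.subtype _)]
  refine card_le_finrank_of_minFac_absNorm K p _ fun v hv ↦ ?_
  simpa using hv

theorem summable_minFac_absNorm :
    Summable fun v : HeightOneSpectrum (𝓞 K) ↦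
      ((Ideal.absNorm v.asIdeal).minFac : ℝ) ^ (-2 : ℝ) := by
  refine (hasSum_card_fiber (fun v : HeightOneSpectrum (𝓞 K) ↦ (Ideal.absNorm v.asIdeal).minFac)
    (finite_minFac_absNorm_fiber K) (g := fun n ↦ (n : ℝ) ^ (-2 : ℝ))
    (fun n ↦ by positivity) ?_).summable
  refine ((Real.summable_nat_rpow.2 (by norm_num : (-2 : ℝ) < -1)).mul_left
    (Module.finrank ℤ (𝓞 K) : ℝ)).of_nonneg_of_le (fun n ↦ by positivity) fun n ↦ ?_
  gcongr
  exact card_minFac_absNorm_fiber_le K n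

/-- The number of ideals of norm `n` if `n` is prime, and zero otherwise. -/
noncomputable def primeIdealCount (n : ℕ) : ℝ :=
  if n.Prime then idealCount K n else 0

theorem summable_primeIdealCount {s : ℝ} (hs : 1 < s) :
    Summable fun n ↦ primeIdealCount K n * (n : ℝ) ^ (-s) := by
  refine (summable_idealCount K hs).of_nonneg_of_le (fun n ↦ ?_) fun n ↦ ?_ <;>
    unfold primeIdealCount <;> split_ifs
  · positivity
  · simp
  · exact le_rfl
  · rw [zero_mul]; positivity

theorem hasSum_primeIdealCount {s : ℝ} (hs : 1 < s) :
    HasSum (fun v : HeightOneSpectrum (𝓞 K) ↦ if (Ideal.absNorm v.asIdeal).Prime then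
      (Ideal.absNorm v.asIdeal : ℝ) ^ (-s) else 0)
      (∑' n, primeIdealCount K n * (n : ℝ) ^ (-s)) := by
  have hg : ∀ n, primeIdealCount K n * (n : ℝ) ^ (-s) =
      (Nat.card {I : Ideal (𝓞 K) // Ideal.absNorm I = n} : ℝ) *
        (if n.Prime then (n : ℝ) ^ (-s) else 0) := by
    intro n
    unfold primeIdealCount
    split_ifs <;> simp [idealCount]
  have h := hasSum_card_fiber (fun I : Ideal (𝓞 K) ↦ Ideal.absNorm I) (finite_ideals_of_norm K)
    (g := fun n ↦ if n.Prime then (n : ℝ) ^ (-s) else 0)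
    (fun n ↦ by split_ifs <;> positivity) ((summable_primeIdealCount K hs).congr hg)
  simp only [← hg] at h
  have hinj : Function.Injective fun v : HeightOneSpectrum (𝓞 K) ↦ v.asIdeal :=
    fun _ _ ↦ HeightOneSpectrum.ext
  refine (hinj.hasSum_iff (f := fun I : Ideal (𝓞 K) ↦ if (Ideal.absNorm I).Prime then
    (Ideal.absNorm I : ℝ) ^ (-s) else 0) fun I hI ↦ if_neg fun hp ↦ hI ?_).2 h
  refine ⟨⟨I, Ideal.isPrime_of_irreducible_absNorm hp, fun h0 ↦ ?_⟩, rfl⟩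
  rw [h0, Ideal.absNorm_bot] at hp
  exact Nat.not_prime_zero hp

theorem neg_log_one_sub_mem {t : ℝ} (h0 : 0 < t) (h1 : t ≤ 1 / 2) :
    t ≤ -Real.log (1 - t) ∧ -Real.log (1 - t) ≤ t + 2 * t ^ 2 := by
  have hpos : 0 < 1 - t := by linarith
  refine ⟨by linarith [Real.log_le_sub_one_of_pos hpos], ?_⟩
  have h := Real.log_le_sub_one_of_pos (inv_pos.2 hpos)
  rw [Real.log_inv] at h
  refine h.trans ?_
  have : (1 - t)⁻¹ ≤ 1 + t + 2 * t ^ 2 := by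
    rw [inv_le_iff_one_le_mul₀ hpos]
    nlinarith [mul_nonneg (sq_nonneg t) (by linarith : 0 ≤ 1 - 2 * t)]
  linarith

theorem norm_neg_log_one_sub_sub_le {s : ℝ} (hs : 1 < s) (v : HeightOneSpectrum (𝓞 K)) :
    ‖-Real.log (1 - (Ideal.absNorm v.asIdeal : ℝ) ^ (-s)) -
      (if (Ideal.absNorm v.asIdeal).Prime then (Ideal.absNorm v.asIdeal : ℝ) ^ (-s) else 0)‖ ≤
    3 * ((Ideal.absNorm v.asIdeal).minFac : ℝ) ^ (-2 : ℝ) := by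
  rw [Real.norm_eq_abs]
  obtain ⟨h0, h1⟩ := absNorm_rpow_mem K hs v
  obtain ⟨h2, h3⟩ := neg_log_one_sub_mem h0 h1
  have hpp := isPrimePow_absNorm K v
  generalize Ideal.absNorm v.asIdeal = N at *
  have hm : N.minFac.Prime := Nat.minFac_prime hpp.ne_one
  have hm0 : (1 : ℝ) ≤ N.minFac := by exact_mod_cast hm.one_le
  have hN0 : (N.minFac : ℝ) ≤ N := by exact_mod_cast Nat.minFac_le hpp.pos
  have hsq : ((N : ℝ) ^ (-s)) ^ 2 ≤ (N.minFac : ℝ) ^ (-2 : ℝ) := by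
    rw [← Real.rpow_natCast, ← Real.rpow_mul (by positivity)]
    calc (N : ℝ) ^ (-s * (2 : ℕ)) ≤ (N : ℝ) ^ (-2 : ℝ) :=
          Real.rpow_le_rpow_of_exponent_le (hm0.trans hN0) (by push_cast; linarith)
      _ ≤ _ := Real.rpow_le_rpow_of_nonpos (by linarith) hN0 (by norm_num)
  have hM2 : 0 ≤ (N.minFac : ℝ) ^ (-2 : ℝ) := by positivity
  split_ifs with hp
  · rw [abs_of_nonneg (by linarith)]
    linarith
  · have hlin : (N : ℝ) ^ (-s) ≤ (N.minFac : ℝ) ^ (-2 : ℝ) := by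
      have hk := hpp.minFac_pow_factorization_eq
      have hk2 : 2 ≤ N.factorization N.minFac := by
        by_contra! hlt
        interval_cases hc : N.factorization N.minFac
        · exact hpp.ne_one (by simpa using hk.symm)
        · rw [pow_one] at hk
          exact hp (hk ▸ hm)
      have hle : ((N.minFac : ℝ) ^ (2 : ℝ)) ≤ N := by
        have : N.minFac ^ 2 ≤ N := (Nat.pow_le_pow_right hm.pos hk2).trans_eq hk
        rw [Real.rpow_two]
        exact_mod_cast this
      calc (N : ℝ) ^ (-s) ≤ (N : ℝ) ^ (-1 : ℝ) :=
            Real.rpow_le_rpow_of_exponent_le (hm0.trans hN0) (by linarith)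
        _ = (N : ℝ)⁻¹ := Real.rpow_neg_one _
        _ ≤ ((N.minFac : ℝ) ^ (2 : ℝ))⁻¹ := by gcongr
        _ = _ := (Real.rpow_neg (by positivity) _).symm
    rw [sub_zero, abs_of_nonneg (by linarith)]
    linarith

/-- Prime ideals of degree one have logarithmic density one. -/
theorem logDensity_primeIdealCount : LogDensity (primeIdealCount K) 1 := by
  refine ⟨fun s hs ↦ summable_primeIdealCount K hs, ?_⟩
  obtain ⟨M, hM⟩ := abs_log_idealZeta_sub_le K
  have hE := ((summable_minFac_absNorm K).mul_left 3)
  refine ⟨(∑' v : HeightOneSpectrum (𝓞 K),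
    3 * ((Ideal.absNorm v.asIdeal).minFac : ℝ) ^ (-2 : ℝ)) + M, ?_⟩
  filter_upwards [hM, self_mem_nhdsWithin] with s hMs hs
  rw [Set.mem_Ioi] at hs
  have hdiff := (hasSum_neg_log_one_sub K hs).sub (hasSum_primeIdealCount K hs)
  have h := tsum_of_norm_bounded hE.hasSum (norm_neg_log_one_sub_sub_le K hs)
  rw [hdiff.tsum_eq, Real.norm_eq_abs, abs_sub_comm] at h
  rw [one_mul]
  exact (abs_sub_le _ _ _).trans (add_le_add h hMs)

end PrimeIdeals

section RootCount

open NumberField Polynomial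

open RingOfIntegers in
theorem card_ideals_of_prime_norm {K : Type*} [Field K] [NumberField K] {θ : 𝓞 K} {p : ℕ}
    [hpf : Fact p.Prime] (hp : ¬ p ∣ exponent θ) :
    Nat.card {I : Ideal (𝓞 K) // Ideal.absNorm I = p} =
      Nat.card {x : ZMod p // eval₂ (Int.castRingHom (ZMod p)) x (minpoly ℤ θ) = 0} := by
  have h0 : (minpoly ℤ θ).map (Int.castRingHom (ZMod p)) ≠ 0 :=
    map_monic_ne_zero (minpoly.monic θ.isIntegral)
  have norm_eq (P : (Ideal.span {(p : ℤ)}).primesOver (𝓞 K)) :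
      p ^ (P : Ideal (𝓞 K)).inertiaDeg ℤ = Ideal.absNorm (P : Ideal (𝓞 K)) := by
    have := P.2.1
    have := P.2.2
    exact Ideal.pow_inertiaDeg p _
  let e₁ : {I : Ideal (𝓞 K) // Ideal.absNorm I = p} ≃
      {P : (Ideal.span {(p : ℤ)}).primesOver (𝓞 K) // (P : Ideal (𝓞 K)).inertiaDeg ℤ = 1} :=
    { toFun := fun I ↦ by
        have hI : (I : Ideal (𝓞 K)) ∈ (Ideal.span {(p : ℤ)}).primesOver (𝓞 K) := by
          have hprime : (I : Ideal (𝓞 K)).IsPrime :=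
            Ideal.isPrime_of_irreducible_absNorm (by rw [I.2]; exact hpf.out)
          refine ⟨hprime, ⟨?_⟩⟩
          refine (Int.ideal_span_isMaximal_of_prime p).eq_of_le ?_ ?_
          · exact (Ideal.IsPrime.under ℤ (I : Ideal (𝓞 K))).ne_top
          · rw [Ideal.span_singleton_le_iff_mem, Ideal.under_def, Ideal.mem_comap]
            have := Ideal.absNorm_mem (I : Ideal (𝓞 K))
            rw [I.2] at this
            simpa using this
        refine ⟨⟨I, hI⟩, ?_⟩
        have h := norm_eq ⟨I, hI⟩
        rw [I.2] at h
        exact Nat.pow_right_injective hpf.out.two_le (h.trans (pow_one p).symm)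
      invFun := fun P ↦ ⟨P.1, by rw [← norm_eq, P.2, pow_one]⟩
      left_inv := fun _ ↦ rfl
      right_inv := fun _ ↦ rfl }
  let e₂ : {P : (Ideal.span {(p : ℤ)}).primesOver (𝓞 K) // (P : Ideal (𝓞 K)).inertiaDeg ℤ = 1} ≃
      {Q : monicFactorsMod θ p // (Q : (ZMod p)[X]).natDegree = 1} :=
    (Ideal.primesOverSpanEquivMonicFactorsMod hp).subtypeEquiv fun P ↦ by
      have := Ideal.inertiaDeg_primesOverSpanEquivMonicFactorsMod_symm_apply' hp
        (Ideal.primesOverSpanEquivMonicFactorsMod hp P).2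
      rw [← this, Subtype.coe_eta, Equiv.symm_apply_apply]
  have mem_iff (x : ZMod p) : X - C x ∈ monicFactorsMod θ p ↔
      eval₂ (Int.castRingHom (ZMod p)) x (minpoly ℤ θ) = 0 := by
    rw [Multiset.mem_toFinset, Polynomial.mem_normalizedFactors_iff h0, dvd_iff_isRoot, IsRoot,
      eval_map]
    simp [irreducible_X_sub_C, monic_X_sub_C]
  let e₃ : {x : ZMod p // eval₂ (Int.castRingHom (ZMod p)) x (minpoly ℤ θ) = 0} →
      {Q : monicFactorsMod θ p // (Q : (ZMod p)[X]).natDegree = 1} :=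
    fun x ↦ ⟨⟨X - C x.1, (mem_iff x).2 x.2⟩, natDegree_X_sub_C _⟩
  have he₃ : Function.Bijective e₃ := by
    refine ⟨fun x y h ↦ ?_, fun Q ↦ ?_⟩
    · have : X - C x.1 = X - C y.1 := congrArg (fun Q ↦ (Q.1 : (ZMod p)[X])) h
      exact Subtype.ext (C_injective (sub_right_injective this))
    · obtain ⟨⟨Q, hQ⟩, hd⟩ := Q
      have hm : Q.Monic := by
        rw [Multiset.mem_toFinset, Polynomial.mem_normalizedFactors_iff h0] at hQ
        exact hQ.2.1
      have hQX : Q = X - C (-Q.coeff 0) := by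
        rw [hm.eq_X_add_C hd]; simp
      have : X - C (-Q.coeff 0) ∈ monicFactorsMod θ p := hQX ▸ hQ
      exact ⟨⟨-Q.coeff 0, (mem_iff _).1 this⟩, Subtype.ext (Subtype.ext hQX.symm)⟩
  rw [Nat.card_congr (e₁.trans e₂), Nat.card_congr (Equiv.ofBijective e₃ he₃)]

theorem exponent_ne_zero {K : Type*} [Field K] [NumberField K] {θ : 𝓞 K}
    (B : PowerBasis ℚ K) (hBgen : B.gen = θ) : RingOfIntegers.exponent θ ≠ 0 := by
  have hint : IsIntegral ℤ (θ : K) := θ.isIntegral_coe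
  obtain ⟨d, hd⟩ := IsIntegrallyClosed.isIntegral_iff.1
    (Algebra.discr_isIntegral ℚ (b := B.basis) fun i ↦ by
      rw [B.basis_eq_pow, hBgen]; exact hint.pow _)
  have hd0 : d ≠ 0 := by
    rintro rfl
    exact Algebra.discr_not_zero_of_basis ℚ B.basis (by rw [← hd]; simp)
  have hmem : (d : 𝓞 K) ∈ conductor ℤ θ := by
    rw [mem_conductor_iff]
    intro b
    have h := Algebra.discr_mul_isIntegral_mem_adjoin ℚ (B := B) (R := ℤ) (hBgen ▸ hint)
      b.isIntegral_coe
    rw [hBgen, Algebra.adjoin_singleton_eq_range_aeval] at h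
    obtain ⟨g, hg⟩ := h
    rw [Algebra.adjoin_singleton_eq_range_aeval]
    refine ⟨g, ?_⟩
    apply RingOfIntegers.coe_injective
    have hcoe : ((aeval θ g : 𝓞 K) : K) = aeval (θ : K) g :=
      (aeval_algebraMap_apply K θ g).symm
    calc ((aeval θ g : 𝓞 K) : K) = Algebra.discr ℚ B.basis • (b : K) := hcoe.trans hg
      _ = ((d * b : 𝓞 K) : K) := by rw [← hd, Algebra.smul_def]; simp
  intro h
  rw [RingOfIntegers.exponent, Ideal.absNorm_eq_zero_iff] at h
  have : d ∈ (conductor ℤ θ).under ℤ := by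
    rw [Ideal.under_def, Ideal.mem_comap]; simpa using hmem
  rw [h] at this
  exact hd0 (by simpa using this)

/-- The number of roots of `f` modulo `n` if `n` is prime, and zero otherwise. -/
noncomputable def rootCount (f : ℤ[X]) (n : ℕ) : ℝ :=
  if n.Prime then Nat.card {x : ZMod n // eval₂ (Int.castRingHom (ZMod n)) x f = 0} else 0

/-- On average over the primes, an irreducible monic integer polynomial has one root. -/
theorem logDensity_rootCount {f : ℤ[X]} (hf : f.Monic) (hirr : Irreducible f) :
    LogDensity (rootCount f) 1 := by
  have hirr' : Irreducible (f.map (algebraMap ℤ ℚ)) :=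
    (hf.irreducible_iff_irreducible_map_fraction_map).1 hirr
  have := Fact.mk hirr'
  have : FiniteDimensional ℚ (AdjoinRoot (f.map (algebraMap ℤ ℚ))) :=
    (AdjoinRoot.powerBasis hirr'.ne_zero).finite
  let K := AdjoinRoot (f.map (algebraMap ℤ ℚ))
  have : NumberField K := NumberField.of_module_finite ℚ K
  have hroot : eval₂ (algebraMap ℤ K) (AdjoinRoot.root (f.map (algebraMap ℤ ℚ)) : K) f = 0 := by
    have := AdjoinRoot.eval₂_root (f.map (algebraMap ℤ ℚ))
    rwa [eval₂_map, RingHom.ext_int ((AdjoinRoot.of _).comp (algebraMap ℤ ℚ)) (algebraMap ℤ K)]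
      at this
  let θ : 𝓞 K := ⟨AdjoinRoot.root _, f, hf, hroot⟩
  have hmin : minpoly ℤ θ = f := by
    have h : minpoly ℚ (algebraMap (𝓞 K) K θ) = f.map (algebraMap ℤ ℚ) := by
      have := AdjoinRoot.minpoly_root hirr'.ne_zero
      rw [(hf.map (algebraMap ℤ ℚ)).leadingCoeff, inv_one, map_one,
        mul_one] at this
      exact this
    rw [minpoly.isIntegrallyClosed_eq_field_fractions ℚ K θ.isIntegral] at h
    exact map_injective _ (algebraMap ℤ ℚ).injective_int h
  have hexp : RingOfIntegers.exponent θ ≠ 0 :=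
    exponent_ne_zero (AdjoinRoot.powerBasis hirr'.ne_zero) (AdjoinRoot.powerBasis_gen _)
  refine (logDensity_primeIdealCount K).congr <|
    (Nat.divisors (RingOfIntegers.exponent θ)).finite_toSet.subset fun p hp ↦ ?_
  rw [Finset.mem_coe, Nat.mem_divisors]
  refine ⟨?_, hexp⟩
  by_contra hnd
  refine hp ?_
  unfold rootCount primeIdealCount
  split_ifs with hprime
  · have := Fact.mk hprime
    rw [idealCount, card_ideals_of_prime_norm hnd, hmin]
  · rfl

end RootCount

section PowerResidues

open Polynomial

theorem exists_pow_mul_eq_pow {F : Type*} [Field F] [Finite F] {q : ℕ} (hq : q.Prime) {c b : F}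
    (hc0 : c ≠ 0) (hb0 : b ≠ 0) (hc : ¬ ∃ x, x ^ q = c) : ∃ i < q, ∃ x, x ^ q = c ^ i * b := by
  let H := (powMonoidHom q : Fˣ →* Fˣ).range
  have hmem (u : Fˣ) (hu : u ∈ H) : ∃ x : F, x ^ q = u := by
    obtain ⟨v, rfl⟩ := hu
    exact ⟨v, by simp⟩
  have hcH : Units.mk0 c hc0 ∉ H := fun h ↦ hc (hmem _ h)
  have hcard : Nat.card (Fˣ ⧸ H) = q := by
    have h := IsCyclic.index_powMonoidHom_range Fˣ q
    refine ((Nat.dvd_prime hq).1 (h ▸ Nat.gcd_dvd_right _ _ : H.index ∣ q)).resolve_left fun h1 ↦ ?_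
    have h1' : H = ⊤ := Subgroup.index_eq_one.1 h1
    exact hcH (h1' ▸ Subgroup.mem_top _)
  have := Fact.mk hq
  have hne : (Units.mk0 c hc0 : Fˣ ⧸ H) ≠ 1 := by
    rwa [Ne, QuotientGroup.eq_one_iff]
  obtain ⟨n, hn⟩ := mem_powers_of_prime_card (g' := ((Units.mk0 b hb0 : Fˣ) : Fˣ ⧸ H)⁻¹) hcard hne
  refine ⟨n % q, Nat.mod_lt _ hq.pos, ?_⟩
  have hn' : (Units.mk0 c hc0 : Fˣ ⧸ H) ^ (n % q) * (Units.mk0 b hb0 : Fˣ) = 1 := by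
    rw [← hcard, pow_mod_natCard, mul_eq_one_iff_eq_inv]
    exact hn
  simpa using hmem _ ((QuotientGroup.eq_one_iff _).1 hn')

theorem card_pow_eq {F : Type*} [Field F] {q : ℕ} {a v : F} (ha : a ≠ 0) (hv : v ^ q = a)
    (hq : q ≠ 0) : Nat.card {x : F // x ^ q = a} = Nat.card {x : F // x ^ q = 1} := by
  have hv0 : v ≠ 0 := by rintro rfl; exact ha (by rw [← hv, zero_pow hq])
  exact Nat.card_congr
    { toFun := fun x ↦ ⟨x / v, by rw [div_pow, x.2, hv, div_self ha]⟩
      invFun := fun x ↦ ⟨x * v, by rw [mul_pow, x.2, hv, one_mul]⟩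
      left_inv := fun x ↦ Subtype.ext (div_mul_cancel₀ _ hv0)
      right_inv := fun x ↦ Subtype.ext (mul_div_cancel_right₀ _ hv0) }

theorem card_root_cyclotomic_lt {F : Type*} [Field F] [Finite F] {q : ℕ} (hq : q.Prime)
    (hqF : (q : F) ≠ 0) :
    Nat.card {x : F // (cyclotomic q F).eval x = 0} + 1 ≤ Nat.card {x : F // x ^ q = 1} := by
  have hs : insert 1 {x : F | (cyclotomic q F).eval x = 0} ⊆ {x : F | x ^ q = 1} := by
    rintro x (rfl | hx)
    · simp
    · have := (cyclotomic.dvd_X_pow_sub_one q F)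
      have := eval_eq_zero_of_dvd_of_eval_eq_zero this hx
      simpa [sub_eq_zero] using this
  have h1 : (1 : F) ∉ {x : F | (cyclotomic q F).eval x = 0} := by
    have := Fact.mk hq
    simpa using hqF
  have := Set.ncard_le_ncard hs (Set.toFinite _)
  rwa [Set.ncard_insert_of_notMem h1 (Set.toFinite _)] at this

theorem card_pow_inequality {F : Type*} [Field F] [Finite F] {q : ℕ} (hq : q.Prime)
    (hqF : (q : F) ≠ 0) {c b : F} (hc : c ≠ 0) (hb : b ≠ 0)
    (hcb : (∃ x, x ^ q = c) → ∃ x, x ^ q = b) :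
    (q - 1) * Nat.card {x : F // x ^ q = c} + 1 + Nat.card {x : F // (cyclotomic q F).eval x = 0} ≤
      ∑ i ∈ Finset.range q, Nat.card {x : F // x ^ q = c ^ i * b} := by
  have hcyc := card_root_cyclotomic_lt hq hqF
  by_cases h : ∃ x, x ^ q = c
  · obtain ⟨y, hy⟩ := hcb h
    obtain ⟨x, hx⟩ := h
    have hsum (i : ℕ) : Nat.card {x : F // x ^ q = c ^ i * b} = Nat.card {x : F // x ^ q = 1} :=
      card_pow_eq (v := x ^ i * y) (by simp [hc, hb])
        (by rw [mul_pow, hy, ← hx, ← pow_mul, ← pow_mul, mul_comm q]) hq.ne_zero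
    simp only [hsum, card_pow_eq hc hx hq.ne_zero, Finset.sum_const, Finset.card_range, smul_eq_mul]
    obtain ⟨m, rfl⟩ := Nat.exists_eq_add_of_lt hq.pos
    simp only [Nat.zero_add, Nat.add_sub_cancel] at *
    nlinarith
  · obtain ⟨i, hi, x, hx⟩ := exists_pow_mul_eq_pow hq hc hb h
    have : IsEmpty {x : F // x ^ q = c} := ⟨fun x ↦ h ⟨x, x.2⟩⟩
    rw [Nat.card_of_isEmpty, mul_zero, zero_add, add_comm]
    refine hcyc.trans ?_
    rw [← card_pow_eq (by simp [hc, hb]) hx hq.ne_zero]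
    exact Finset.single_le_sum (f := fun i ↦ Nat.card {x : F // x ^ q = c ^ i * b})
      (fun _ _ ↦ Nat.zero_le _) (Finset.mem_range.2 hi)

theorem logDensity_rootCount_X_pow_sub_C {q : ℕ} (hq : q.Prime) {a : ℤ}
    (ha : ∀ x : ℚ, x ^ q ≠ a) : LogDensity (rootCount (X ^ q - C a)) 1 := by
  have hm : (X ^ q - C a : ℤ[X]).Monic := monic_X_pow_sub_C a hq.ne_zero
  refine logDensity_rootCount hm ((hm.irreducible_iff_irreducible_map_fraction_map (K := ℚ)).2 ?_)
  simpa using X_pow_sub_C_irreducible_of_prime hq ha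

/-- A weak form of the Chebotarev density theorem for the Kummer extension generated by the `q`-th
roots of `c` and `b`. -/
theorem infinite_setOf_prime_pow_residue {q : ℕ} (hq : q.Prime) {c b : ℤ}
    (hc : ∀ x : ℚ, x ^ q ≠ c) (hb : ∀ i < q, ∀ x : ℚ, x ^ q ≠ (c ^ i * b : ℤ)) :
    {p : ℕ | p.Prime ∧ (∃ x : ZMod p, x ^ q = c) ∧ ¬ ∃ x : ZMod p, x ^ q = b}.Infinite := by
  intro hfin
  have hc0 : c ≠ 0 := by rintro rfl; exact hc 0 (by simp [hq.ne_zero])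
  have hb0 : b ≠ 0 := by rintro rfl; exact hb 0 hq.pos 0 (by simp [hq.ne_zero])
  have hsum := LogDensity.sum (Finset.range q) (a := fun i ↦ rootCount (X ^ q - C (c ^ i * b)))
    (c := fun _ ↦ 1) fun i hi ↦ logDensity_rootCount_X_pow_sub_C hq (hb i (Finset.mem_range.1 hi))
  have hdens := ((hsum.add ((logDensity_rootCount_X_pow_sub_C hq hc).const_mul (-(q - 1)))).add
    ((logDensity_rootCount monic_X irreducible_X).const_mul (-1))).add
    ((logDensity_rootCount (cyclotomic.monic q ℤ) (cyclotomic.irreducible hq.pos)).const_mul (-1))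
  have := hdens.nonneg <| (hfin.union (Nat.divisors (q * (c * b).natAbs)).finite_toSet).subset
    fun p hp ↦ by
      by_contra hcon
      refine not_le_of_gt (Set.mem_ofPred.1 hp) ?_
      by_cases hprime : p.Prime
      · have := Fact.mk hprime
        simp only [Set.mem_union, Set.mem_ofPred_eq, Finset.mem_coe, Nat.mem_divisors, not_or,
          not_and, hprime, true_and, not_not] at hcon
        obtain ⟨hres, hdvd⟩ := hcon
        have hndvd : ¬ p ∣ q * (c * b).natAbs := fun h ↦ by
          simpa [hq.ne_zero, hc0, hb0] using hdvd h
        rw [hprime.dvd_mul, Int.natAbs_mul, hprime.dvd_mul, not_or, not_or,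
          ← Int.natCast_dvd, ← Int.natCast_dvd, ← ZMod.natCast_eq_zero_iff,
          ← ZMod.intCast_zmod_eq_zero_iff_dvd, ← ZMod.intCast_zmod_eq_zero_iff_dvd] at hndvd
        have key := card_pow_inequality hq hndvd.1 hndvd.2.1 hndvd.2.2 hres
        have hsub (a : ℤ) : rootCount (X ^ q - C a) p = Nat.card {x : ZMod p // x ^ q = a} := by
          simp only [rootCount, hprime, if_true, ← eval_map]
          simp [sub_eq_zero]
        have hX : rootCount X p = 1 := by simp [rootCount, hprime]
        have hcyc : rootCount (cyclotomic q ℤ) p =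
            Nat.card {x : ZMod p // (cyclotomic q (ZMod p)).eval x = 0} := by
          simp only [rootCount, hprime, if_true, ← eval_map, map_cyclotomic]
        rw [hcyc, hX, hsub]
        simp only [hsub, Int.cast_mul, Int.cast_pow]
        have key' := (Nat.cast_le (α := ℝ)).2 key
        push_cast [Nat.cast_sub hq.one_le] at key'
        linarith
      · simp [rootCount, hprime]
  simp at this
  linarith

end PowerResidues

theorem padicValRat_eq_zero {p : ℕ} {x : ℚ} (h1 : ¬ (p : ℤ) ∣ x.num) (h2 : ¬ p ∣ x.den) :
    padicValRat p x = 0 := by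
  rw [padicValRat_def, padicValInt.eq_zero_of_not_dvd h1, padicValNat.eq_zero_of_not_dvd h2]
  rfl

theorem finite_setOf_padicValRat_ne_zero {x : ℚ} (hx : x ≠ 0) :
    {p : ℕ | padicValRat p x ≠ 0}.Finite := by
  refine (Nat.divisors (x.num.natAbs * x.den)).finite_toSet.subset fun p hp ↦ ?_
  rw [Finset.mem_coe, Nat.mem_divisors]
  refine ⟨?_, by simp [hx]⟩
  by_contra h
  exact hp (padicValRat_eq_zero (fun h' ↦ h ((Int.natCast_dvd.1 h').mul_right _))
    fun h' ↦ h (h'.mul_left _))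

theorem exists_prime_padicValRat_ne_zero {x : ℚ} (hx : x ≠ 0) (h1 : x ≠ 1) (h2 : x ≠ -1) :
    ∃ p : ℕ, p.Prime ∧ padicValRat p x ≠ 0 := by
  by_contra! h
  have hcop := x.reduced
  have hnd (p : ℕ) (hp : p.Prime) : ¬ p ∣ x.num.natAbs ∧ ¬ p ∣ x.den := by
    have := Fact.mk hp
    have hv := h p hp
    rw [padicValRat_def, sub_eq_zero, Nat.cast_inj] at hv
    have h1 : p ∣ x.num.natAbs ↔ padicValInt p x.num ≠ 0 := by
      rw [padicValInt, ← dvd_iff_padicValNat_ne_zero (by simpa using hx)]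
    have h2 : p ∣ x.den ↔ padicValNat p x.den ≠ 0 := dvd_iff_padicValNat_ne_zero x.den_nz
    have : ¬ (p ∣ x.num.natAbs ∧ p ∣ x.den) := fun hh ↦
      Nat.not_coprime_of_dvd_of_dvd hp.one_lt hh.1 hh.2 hcop
    rw [h1, h2, hv] at this
    rw [h1, h2, hv]
    tauto
  have hn : x.num.natAbs = 1 := by
    by_contra hne
    obtain ⟨p, hp, hd⟩ := Nat.exists_prime_and_dvd hne
    exact (hnd p hp).1 hd
  have hd : x.den = 1 := by
    by_contra hne
    obtain ⟨p, hp, hd⟩ := Nat.exists_prime_and_dvd hne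
    exact (hnd p hp).2 hd
  rw [← Rat.num_div_den x, hd] at h1 h2
  rcases Int.natAbs_eq x.num with h | h <;> rw [hn] at h <;> simp [h] at h1 h2

theorem exists_prime_not_pow {B C : ℚ} (hB : B ≠ 0) (hC : C ≠ 0) (hC1 : C ≠ 1) (hC2 : C ≠ -1)
    (h : ∀ k : ℤ, k ≠ 0 → ∀ l : ℤ, B ^ k * C ^ l ≠ 1 ∧ B ^ k * C ^ l ≠ -1) :
    ∃ q : ℕ, q.Prime ∧ ∀ x : ℚ, x ^ q ≠ C ∧ ∀ i : ℕ, x ^ q ≠ C ^ i * B := by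
  obtain ⟨l, hl, hlC⟩ := exists_prime_padicValRat_ne_zero hC hC1 hC2
  obtain ⟨h1, h2⟩ := h (padicValRat l C) hlC (-padicValRat l B)
  obtain ⟨m, hm, hD⟩ := exists_prime_padicValRat_ne_zero
    (mul_ne_zero (zpow_ne_zero _ hB) (zpow_ne_zero _ hC)) h1 h2
  have := Fact.mk hl
  have := Fact.mk hm
  rw [padicValRat.mul (zpow_ne_zero _ hB) (zpow_ne_zero _ hC), padicValRat.zpow, padicValRat.zpow]
    at hD
  obtain ⟨q, hqD, hq⟩ := Nat.exists_infinite_primes ((padicValRat l C * padicValRat m B +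
    -padicValRat l B * padicValRat m C).natAbs + 1)
  have hnd : ¬ (q : ℤ) ∣ padicValRat l C * padicValRat m B +
    -padicValRat l B * padicValRat m C := fun hd ↦ by
    have := Nat.le_of_dvd (Int.natAbs_pos.2 hD) (Int.natCast_dvd.1 hd)
    omega
  refine ⟨q, hq, fun x ↦ ⟨fun hx ↦ hnd ?_, fun i hx ↦ hnd ?_⟩⟩
  · have hl := congrArg (padicValRat l) hx
    have hm := congrArg (padicValRat m) hx
    rw [padicValRat.pow] at hl hm
    rw [← hl, ← hm]
    exact ⟨padicValRat l x * padicValRat m B - padicValRat l B * padicValRat m x, by ring⟩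
  · have hl := congrArg (padicValRat l) hx
    have hm := congrArg (padicValRat m) hx
    rw [padicValRat.pow, padicValRat.mul (pow_ne_zero _ hC) hB, padicValRat.pow] at hl hm
    refine ⟨padicValRat l C * padicValRat m x - padicValRat l x * padicValRat m C, ?_⟩
    linear_combination padicValRat m C * hl - padicValRat l C * hm

theorem padicNorm_eq_one {p : ℕ} {x : ℚ} (hx : x ≠ 0) (h : padicValRat p x = 0) :
    padicNorm p x = 1 := by
  rw [padicNorm.eq_zpow_of_nonzero hx, h]; simp

theorem exists_pow_eq_of_padicNorm_lt_one {p q : ℕ} [Fact p.Prime] (hq : q ≠ 0) {B C : ℚ}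
    (hC : C ≠ 0) (hCp : padicValRat p C = 0)
    (hCn : (C.num : ZMod p) ≠ 0) (hCd : (C.den : ZMod p) ≠ 0)
    (hres : ∃ x : ZMod p, x ^ q = (C.num * C.den ^ (q - 1) : ℤ))
    {n : ℤ} (hn : padicNorm p (C ^ n - B) < 1) :
    ∃ x : ZMod p, x ^ q = (B.num * B.den ^ (q - 1) : ℤ) := by
  obtain ⟨i, j, rfl⟩ : ∃ i j : ℕ, n = i - j := ⟨n.toNat, (-n).toNat, by omega⟩
  have hint : padicNorm p ((C.num ^ i * C.den ^ j * B.den - B.num * C.num ^ j * C.den ^ i : ℤ) : ℚ)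
      < 1 := by
    have hd : (C.den : ℚ) ≠ 0 := by simp
    have hd' : (B.den : ℚ) ≠ 0 := by simp
    have heq : ((C.num ^ i * C.den ^ j * B.den - B.num * C.num ^ j * C.den ^ i : ℤ) : ℚ) =
        (C ^ ((i : ℤ) - j) - B) * (C ^ j * (C.den ^ (i + j) * B.den : ℤ)) := by
      have hCe : (C.num : ℚ) = C * C.den := (Rat.mul_den_eq_num C).symm
      have hBe : (B.num : ℚ) = B * B.den := (Rat.mul_den_eq_num B).symm
      push_cast
      rw [hCe, hBe, zpow_sub₀ hC, zpow_natCast, zpow_natCast]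
      field_simp
      ring
    rw [heq, padicNorm.mul, padicNorm.mul,
      padicNorm_eq_one (pow_ne_zero _ hC) (by rw [padicValRat.pow, hCp, mul_zero]), one_mul]
    exact mul_lt_one_of_nonneg_of_lt_one_left (padicNorm.nonneg _) hn (padicNorm.of_int _)
  rw [padicNorm.int_lt_one_iff, ← ZMod.intCast_zmod_eq_zero_iff_dvd] at hint
  obtain ⟨x, hx⟩ := hres
  push_cast at hint hx ⊢
  generalize (C.num : ZMod p) = s at *
  generalize (C.den : ZMod p) = t at *
  generalize (B.num : ZMod p) = r at *
  generalize (B.den : ZMod p) = w at *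
  obtain ⟨m, rfl⟩ := Nat.exists_eq_succ_of_ne_zero hq
  simp only [Nat.succ_eq_add_one, Nat.add_sub_cancel] at *
  have hx0 : x ≠ 0 := by
    rintro rfl
    rw [zero_pow hq] at hx
    exact mul_ne_zero hCn (pow_ne_zero _ hCd) hx.symm
  refine ⟨w * (x / t) ^ i / (x / t) ^ j, ?_⟩
  have hs : s = t * (x / t) ^ (m + 1) := by
    rw [div_pow, hx]; field_simp; ring
  have hy0 : x / t ≠ 0 := div_ne_zero hx0 hCd
  generalize x / t = y at *
  subst hs
  have h2 : y ^ ((m + 1) * i) * w = r * y ^ ((m + 1) * j) := by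
    have : t ^ (i + j) * (y ^ ((m + 1) * i) * w - r * y ^ ((m + 1) * j)) = 0 := by
      rw [← hint]; ring
    exact sub_eq_zero.1 ((mul_eq_zero.1 this).resolve_left (pow_ne_zero _ hCd))
  rw [div_pow, div_eq_iff (pow_ne_zero _ (pow_ne_zero _ hy0))]
  calc (w * y ^ i) ^ (m + 1) = (y ^ ((m + 1) * i) * w) * w ^ m := by ring
    _ = r * w ^ m * (y ^ j) ^ (m + 1) := by rw [h2]; ring

theorem finite_setOf_natCast_eq_zero {m : ℕ} (hm : m ≠ 0) : {p : ℕ | (m : ZMod p) = 0}.Finite :=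
  m.divisors.finite_toSet.subset fun p hp ↦ by
    rw [Finset.mem_coe, Nat.mem_divisors]
    exact ⟨(ZMod.natCast_eq_zero_iff _ _).1 hp, hm⟩

theorem infinite_setOf_prime_zpow_sub {B C : ℚ} (hB : B ≠ 0) (hC : C ≠ 0) (hC1 : C ≠ 1)
    (h : ∀ k : ℤ, k ≠ 0 → ∀ l : ℤ, B ^ k * C ^ l ≠ 1 ∧ B ^ k * C ^ l ≠ -1) :
    {p : ℕ | p.Prime ∧ ∀ n : ℤ, ¬ padicNorm p (C ^ n - B) < 1}.Infinite := by
  by_cases hC2 : C = -1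
  · obtain ⟨h1, h2⟩ : B ≠ 1 ∧ B ≠ -1 := by simpa using h 1 one_ne_zero 0
    have h1' : 1 - B ≠ 0 := sub_ne_zero.2 h1.symm
    have h2' : -1 - B ≠ 0 := sub_ne_zero.2 h2.symm
    refine (Nat.infinite_setOfPred_prime.sdiff ((finite_setOf_padicValRat_ne_zero h1').union
      (finite_setOf_padicValRat_ne_zero h2'))).mono fun p hp ↦ ⟨hp.1, fun n ↦ not_lt.2 ?_⟩
    have hp2 := hp.2
    simp only [Set.mem_union, Set.mem_ofPred_eq, not_or, not_not] at hp2
    rcases Int.even_or_odd n with hn | hn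
    · rw [hC2, hn.neg_one_zpow, padicNorm_eq_one h1' hp2.1]
    · rw [hC2, hn.neg_one_zpow, padicNorm_eq_one h2' hp2.2]
  obtain ⟨q, hq, hpow⟩ := exists_prime_not_pow hB hC hC1 hC2 h
  have hden (x : ℚ) : ((x.num * x.den ^ (q - 1) : ℤ) : ℚ) = x * x.den ^ q := by
    obtain ⟨m, rfl⟩ := Nat.exists_eq_add_one_of_ne_zero hq.ne_zero
    have hxe : (x.num : ℚ) = x * x.den := (Rat.mul_den_eq_num x).symm
    push_cast
    rw [hxe, pow_succ]; ring
  have hinf := infinite_setOf_prime_pow_residue hq (c := C.num * C.den ^ (q - 1))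
    (b := B.num * B.den ^ (q - 1)) (fun x hx ↦ (hpow (x / C.den)).1 <| by
      rw [hden] at hx
      rw [div_pow, hx, mul_div_cancel_right₀ _ (by simp)])
    (fun i _ x hx ↦ (hpow (x / (C.den ^ i * B.den))).2 i <| by
      rw [Int.cast_mul, Int.cast_pow, hden, hden] at hx
      rw [div_pow, hx, div_eq_iff (by simp)]
      ring)
  refine (hinf.sdiff (((finite_setOf_padicValRat_ne_zero hC).union
    (finite_setOf_natCast_eq_zero (Int.natAbs_ne_zero.2 (Rat.num_ne_zero.2 hC)))).union
    (finite_setOf_natCast_eq_zero C.den_nz))).mono fun p hp ↦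
      ⟨hp.1.1, fun n hn ↦ hp.1.2.2 ?_⟩
  have := Fact.mk hp.1.1
  have hp2 := hp.2
  simp only [Set.mem_union, Set.mem_ofPred_eq, not_or, not_not] at hp2
  refine exists_pow_eq_of_padicNorm_lt_one hq.ne_zero hC hp2.1.1 ?_ hp2.2 hp.1.2.1 hn
  rw [Ne, ZMod.intCast_zmod_eq_zero_iff_dvd, Int.natCast_dvd, ← ZMod.natCast_eq_zero_iff]
  exact hp2.1.2

theorem padicNorm_lt_one_of_inMulZb {p b : ℕ} [Fact p.Prime] (hb : b.gcd p = 1) {x : ℚ}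
    (h : inMulZb p b x) : padicNorm p x < 1 := by
  obtain ⟨z, j, rfl⟩ := h
  have hbp : padicNorm p b = 1 := by
    rw [padicNorm.nat_eq_one_iff]
    exact (Nat.Prime.coprime_iff_not_dvd Fact.out).1 (Nat.Coprime.symm hb)
  have hbj : padicNorm p ((b : ℚ) ^ j) = 1 := by
    rw [IsAbsoluteValue.abv_pow (padicNorm p), hbp, one_pow]
  rw [padicNorm.div, hbj, div_one, padicNorm.mul]
  exact mul_lt_one_of_nonneg_of_lt_one_left (padicNorm.nonneg _)
    padicNorm.padicNorm_p_lt_one_of_prime (padicNorm.of_int _)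

theorem stmt11 (b : ℕ) (hb : 0 < b) (b₁ b₂ c₁ c₂ : ℚ)
    (hb₁ : b₁ ≠ 0) (hb₂ : b₂ ≠ 0) (hc₁ : c₁ ≠ 0) (hc₂ : c₂ ≠ 0) (hne : c₁ ≠ c₂)
    (u : ℤ → ℚ) (hu : ∀ n : ℤ, u n = b₁ * c₁ ^ n + b₂ * c₂ ^ n)
    (hmem : ∀ n : ℤ, inZb b (u n))
    (B C : ℚ) (hB : B = -b₂ / b₁) (hC : C = c₁ / c₂)
    (hcase : (∃ m : ℤ, C ^ m = B) ∨ (C = 1 ∧ B = -1) ∨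
      (∀ k : ℤ, k ≠ 0 → ∀ l : ℤ, B ^ k * C ^ l ≠ 1 ∧ B ^ k * C ^ l ≠ -1)) :
    (∀ n : ℤ, u n ≠ 0) ↔
      {p : ℕ | p.Prime ∧ Nat.gcd b p = 1 ∧ ∀ n : ℤ, ¬ inMulZb p b (u n)}.Infinite := by
  have hC0 : C ≠ 0 := hC ▸ div_ne_zero hc₁ hc₂
  have hB0 : B ≠ 0 := hB ▸ div_ne_zero (neg_ne_zero.2 hb₂) hb₁
  have hC1 : C ≠ 1 := fun h ↦ hne ((div_eq_one_iff_eq hc₂).1 (hC ▸ h))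
  have hun (n : ℤ) : u n = b₁ * c₂ ^ n * (C ^ n - B) := by
    rw [hu, hC, hB, div_zpow]
    field_simp
    ring
  constructor
  · intro hne0
    rcases hcase with ⟨m, hm⟩ | ⟨h1, -⟩ | h
    · exact absurd (by rw [hun, hm, sub_self, mul_zero]) (hne0 m)
    · exact absurd h1 hC1
    refine ((infinite_setOf_prime_zpow_sub hB0 hC0 hC1 h).sdiff
      (((finite_setOf_padicValRat_ne_zero hb₁).union (finite_setOf_padicValRat_ne_zero hc₂)).union
        (finite_setOf_natCast_eq_zero hb.ne'))).mono fun p hp ↦ ?_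
    have := Fact.mk hp.1.1
    have hp2 := hp.2
    simp only [Set.mem_union, Set.mem_ofPred_eq, not_or, not_not] at hp2
    have hgcd : b.gcd p = 1 := Nat.Coprime.symm <| (Nat.Prime.coprime_iff_not_dvd hp.1.1).2
      fun hd ↦ hp2.2 ((ZMod.natCast_eq_zero_iff _ _).2 hd)
    refine ⟨hp.1.1, hgcd, fun n hn ↦ hp.1.2 n ?_⟩
    have hlt := padicNorm_lt_one_of_inMulZb hgcd hn
    rwa [hun, padicNorm.mul, padicNorm_eq_one (mul_ne_zero hb₁ (zpow_ne_zero _ hc₂)), one_mul]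
      at hlt
    rw [padicValRat.mul hb₁ (zpow_ne_zero _ hc₂), padicValRat.zpow, hp2.1.1, hp2.1.2]
    simp
  · intro hinf n hn
    obtain ⟨p, -, -, hp⟩ := hinf.nonempty
    exact hp n ⟨0, 0, by simp [hn]⟩
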